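/- Lévy continuity via convolution: for each N let W_N and Y_N be independent real random variables, and suppose W_N converges in distribution to W with E[e^{itW}] ≠ 0 for all t ∈ ℝ. Then Y_N converges in distribution to Y if and only if W_N + Y_N converges in distribution to W + Y (with W independent of Y). -/

import Mathlib

open MeasureTheory ProbabilityTheory Filter
open scoped BoundedContinuousFunction

noncomputable section

/-- Convergence in distribution of real random variables, tested against bounded continuous
functions, is equivalent to pointwise convergence of the characteristic functions of their laws. -/
theorem forall_tendsto_integral_iff_tendsto_charFun {Ω Ω' : Type*}
    [MeasurableSpace Ω] [MeasurableSpace Ω'] {μ : Measure Ω} {μ' : Measure Ω'}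
    [IsProbabilityMeasure μ] [IsProbabilityMeasure μ'] {X : ℕ → Ω → ℝ} {X₀ : Ω' → ℝ}
    (hX : ∀ n, Measurable (X n)) (hX₀ : Measurable X₀) :
    (∀ f : ℝ →ᵇ ℝ,
        Tendsto (fun n => ∫ ω, f (X n ω) ∂μ) atTop (nhds (∫ ω, f (X₀ ω) ∂μ')))
      ↔ ∀ t, Tendsto (fun n => charFun (μ.map (X n)) t) atTop (nhds (charFun (μ'.map X₀) t)) := by
  let ν : ℕ → ProbabilityMeasure ℝ := fun n =>
    ⟨μ.map (X n), Measure.isProbabilityMeasure_map (hX n).aemeasurable⟩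
  let ν₀ : ProbabilityMeasure ℝ :=
    ⟨μ'.map X₀, Measure.isProbabilityMeasure_map hX₀.aemeasurable⟩
  have hν (n : ℕ) (f : ℝ →ᵇ ℝ) : ∫ x, f x ∂(ν n : Measure ℝ) = ∫ ω, f (X n ω) ∂μ :=
    integral_map (hX n).aemeasurable f.continuous.aestronglyMeasurable
  have hν₀ (f : ℝ →ᵇ ℝ) : ∫ x, f x ∂(ν₀ : Measure ℝ) = ∫ ω, f (X₀ ω) ∂μ' :=
    integral_map hX₀.aemeasurable f.continuous.aestronglyMeasurable
  have h := ProbabilityMeasure.tendsto_iff_tendsto_charFun (μ := ν) (μ₀ := ν₀)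
  rw [ProbabilityMeasure.tendsto_iff_forall_integral_tendsto] at h
  simp only [hν, hν₀] at h
  exact h

/-- Lévy continuity via convolution: if `W_N ⊥ Y_N`, `W_N → W` in
distribution and the characteristic function of `W` never vanishes, then
`Y_N → Y` in distribution iff `W_N + Y_N → W + Y` in distribution (with `W`
independent of `Y`). -/
theorem convergence_in_distribution_convolution {Ω Ω' : Type*}
    [MeasurableSpace Ω] [MeasurableSpace Ω'] (μ : Measure Ω) (μ' : Measure Ω')
    [IsProbabilityMeasure μ] [IsProbabilityMeasure μ']
    (W Y : ℕ → Ω → ℝ) (W₀ Y₀ : Ω' → ℝ)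
    (hWm : ∀ n, Measurable (W n)) (hYm : ∀ n, Measurable (Y n))
    (hW₀m : Measurable W₀) (hY₀m : Measurable Y₀)
    (hindep : ∀ n, IndepFun (W n) (Y n) μ) (hindep₀ : IndepFun W₀ Y₀ μ')
    (hchar : ∀ t : ℝ, (∫ ω, Complex.exp (Complex.I * (t * W₀ ω : ℝ)) ∂μ') ≠ 0)
    (hWconv : ∀ f : ℝ →ᵇ ℝ,
      Tendsto (fun n => ∫ ω, f (W n ω) ∂μ) atTop (nhds (∫ ω, f (W₀ ω) ∂μ'))) :
    (∀ f : ℝ →ᵇ ℝ,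
        Tendsto (fun n => ∫ ω, f (Y n ω) ∂μ) atTop (nhds (∫ ω, f (Y₀ ω) ∂μ')))
      ↔ (∀ f : ℝ →ᵇ ℝ,
        Tendsto (fun n => ∫ ω, f (W n ω + Y n ω) ∂μ) atTop
          (nhds (∫ ω, f (W₀ ω + Y₀ ω) ∂μ'))) := by
  have hW := (forall_tendsto_integral_iff_tendsto_charFun hWm hW₀m).1 hWconv
  have hne (t : ℝ) : charFun (μ'.map W₀) t ≠ 0 := by
    rw [charFun_apply_real, integral_map hW₀m.aemeasurable (by fun_prop)]
    simpa [mul_comm] using hchar t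
  rw [forall_tendsto_integral_iff_tendsto_charFun hYm hY₀m,
    forall_tendsto_integral_iff_tendsto_charFun (fun n => (hWm n).fun_add (hYm n))
      (hW₀m.fun_add hY₀m)]
  refine forall_congr' fun t => ?_
  simp only [(hindep _).charFun_map_fun_add_eq_mul (hWm _).aemeasurable (hYm _).aemeasurable,
    hindep₀.charFun_map_fun_add_eq_mul hW₀m.aemeasurable hY₀m.aemeasurable, Pi.mul_apply]
  refine ⟨(hW t).mul, fun h => ?_⟩
  have hdiv := h.div (hW t) (hne t)
  rw [mul_div_cancel_left₀ _ (hne t)] at hdiv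
  refine hdiv.congr' ?_
  filter_upwards [(hW t).eventually_ne (hne t)] with n hn
  exact mul_div_cancel_left₀ _ hn
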